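/- arXiv:0806.1709 — 2 statements merged into one kernel-verified Lean document; each statement's English description precedes it below -/
import Mathlib

section
/- Let n ≥ 1, let Ω ⊆ ℝⁿ be a measurable set of finite Lebesgue measure |Ω|, and let (φ_i)_{i ∈ I} be an orthonormal family in L²(ℝⁿ) such that each φ_i vanishes almost everywhere outside Ω. Then for every p ∈ ℝⁿ: Σ_{i ∈ I} |φ̂_i(p)|² ≤ (2π)^{−n} · |Ω|, where φ̂(p) = (2π)^{−n/2} ∫_{ℝⁿ} φ(x) e^{−i p·x} dx (which is well defined since each φ_i lies in L¹(ℝⁿ)). -/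
open MeasureTheory
open scoped ENNReal

section CutoffCharacter

variable {E : Type*} [NormedAddCommGroup E] [InnerProductSpace ℝ E] [MeasurableSpace E]
  [BorelSpace E]

/-- The character `x ↦ exp (i p·x)`, cut off to a measurable set of finite measure, is in `L²`. -/
lemma memLp_indicator_exp_inner {μ : Measure E} {Ω : Set E}
    (hΩ : MeasurableSet Ω) (hμ : μ Ω ≠ ⊤) (p : E) :
    MemLp (Ω.indicator fun x ↦ Complex.exp (Complex.I * ((inner ℝ p x : ℝ) : ℂ))) 2 μ := by
  refine (memLp_indicator_const 2 hΩ (1 : ℂ) (Or.inr hμ)).mono ?_ ?_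
  · have hc : Continuous fun x : E ↦ Complex.exp (Complex.I * ((inner ℝ p x : ℝ) : ℂ)) := by
      fun_prop
    have hm : Measurable fun x : E ↦ Complex.exp (Complex.I * ((inner ℝ p x : ℝ) : ℂ)) :=
      hc.measurable
    exact (hm.indicator hΩ).aestronglyMeasurable
  · refine .of_forall fun x ↦ ?_
    by_cases hx : x ∈ Ω <;> simp [hx, Complex.norm_exp]

/-- The squared `L²` norm of a character cut off to `Ω` is at most the measure of `Ω`. -/
lemma norm_sq_toLp_indicator_exp_inner_le {μ : Measure E} {Ω : Set E}
    (hΩ : MeasurableSet Ω) (hμ : μ Ω ≠ ⊤) (p : E) :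
    ‖(memLp_indicator_exp_inner hΩ hμ p).toLp _‖ ^ 2 ≤ (μ Ω).toReal := by
  have h : ‖(memLp_indicator_exp_inner hΩ hμ p).toLp _‖ ≤
      ‖indicatorConstLp 2 hΩ hμ (1 : ℂ)‖ := by
    refine Lp.norm_le_norm_of_ae_le ?_
    filter_upwards [(memLp_indicator_exp_inner hΩ hμ p).coeFn_toLp,
      indicatorConstLp_coeFn (p := 2) (hs := hΩ) (hμs := hμ) (c := (1 : ℂ))] with x h₁ h₂
    rw [h₁, h₂]
    by_cases hx : x ∈ Ω <;> simp [hx, Complex.norm_exp]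
  refine (pow_le_pow_left₀ (norm_nonneg _) h 2).trans_eq ?_
  rw [norm_indicatorConstLp two_ne_zero ENNReal.ofNat_ne_top, norm_one, one_mul,
    ENNReal.toReal_ofNat, ← Real.sqrt_eq_rpow, Real.sq_sqrt measureReal_nonneg, Measure.real]

/-- Pairing an `L²` function vanishing outside `Ω` with the cut-off character gives its
unnormalized Fourier integral. -/
lemma inner_toLp_indicator_exp_inner {μ : Measure E} {Ω : Set E}
    (hΩ : MeasurableSet Ω) (hμ : μ Ω ≠ ⊤) (p : E) (f : Lp ℂ 2 μ)
    (hf : ∀ᵐ x ∂μ, x ∉ Ω → f x = 0) :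
    inner ℂ ((memLp_indicator_exp_inner hΩ hμ p).toLp _) f =
      ∫ x, f x * Complex.exp (-Complex.I * ((inner ℝ p x : ℝ) : ℂ)) ∂μ := by
  rw [L2.inner_def]
  refine integral_congr_ae ?_
  filter_upwards [(memLp_indicator_exp_inner hΩ hμ p).coeFn_toLp, hf] with x h₁ h₂
  rw [h₁]
  by_cases hx : x ∈ Ω
  · simp [hx, ← Complex.exp_conj]
  · simp [hx, h₂ hx]

end CutoffCharacter

/-- Bessel-type bound: for an orthonormal family in `L²(ℝⁿ)` supported in a set `Ω` of finite
measure, the values of the Fourier transforms at any fixed point `p` satisfy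
`Σ_i |φ̂_i(p)|² ≤ (2π)^{−n} |Ω|`. -/
theorem sum_sq_fourier_coeff_le (n : ℕ) (hn : 1 ≤ n)
    (Ω : Set (EuclideanSpace ℝ (Fin n))) (hΩmeas : MeasurableSet Ω) (hΩ : volume Ω < ⊤)
    (I : Type*) (φ : I → Lp ℂ 2 (volume : Measure (EuclideanSpace ℝ (Fin n))))
    (hortho : Orthonormal ℂ φ)
    (hsupp : ∀ i : I, ∀ᵐ x : EuclideanSpace ℝ (Fin n), x ∉ Ω → φ i x = 0)
    (p : EuclideanSpace ℝ (Fin n)) :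
    ∑' i : I,
        ‖(((2 * Real.pi) ^ (-(n : ℝ) / 2) : ℝ) : ℂ) *
            ∫ x : EuclideanSpace ℝ (Fin n),
              φ i x * Complex.exp (-Complex.I * ((inner ℝ p x : ℝ) : ℂ))‖ ^ 2
      ≤ (2 * Real.pi) ^ (-(n : ℝ)) * (volume Ω).toReal := by
  have hconst : ((2 * Real.pi) ^ (-(n : ℝ) / 2)) ^ 2 = (2 * Real.pi) ^ (-(n : ℝ)) := by
    rw [← Real.rpow_natCast, ← Real.rpow_mul (by positivity)]
    congr 1
    push_cast
    ring
  have hcoeff (i : I) := inner_toLp_indicator_exp_inner hΩmeas hΩ.ne p (φ i) (hsupp i)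
  simp_rw [norm_mul, mul_pow, Complex.norm_real, Real.norm_eq_abs, sq_abs, hconst, ← hcoeff,
    norm_inner_symm _ (φ _)]
  rw [tsum_mul_left]
  gcongr
  exact (hortho.tsum_inner_products_le _).trans
    (norm_sq_toLp_indicator_exp_inner_le hΩmeas hΩ.ne p)
end

section
/- Let n ≥ 1, let Ω ⊆ ℝⁿ be a measurable set of finite Lebesgue measure |Ω|, let (φ_i)_{i ∈ I} be an orthonormal family in L²(ℝⁿ) such that each φ_i vanishes almost everywhere outside Ω, and let f : [0, ∞) → [0, ∞) be a convex continuous function with ∫_{ℝⁿ} f(‖p‖²) dp < ∞. Assume that for each i the kinetic energy q_i := ∫_{ℝⁿ} ‖p‖² |φ̂_i(p)|² dp is finite. Then Σ_{i ∈ I} f(q_i) ≤ (2π)^{−n} · |Ω| · ∫_{ℝⁿ} f(‖p‖²) dp (a Li–Yau type bound for orthonormal families). -/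
open MeasureTheory
open scoped ENNReal

section PlancherelIntegral

open FourierTransform SchwartzMap
open scoped ContDiff

variable {V : Type*} [NormedAddCommGroup V] [InnerProductSpace ℝ V] [FiniteDimensional ℝ V]
  [MeasurableSpace V] [BorelSpace V]

/-- The Fourier transform of an integrable function is continuous. -/
theorem continuous_fourier_of_integrable {g : V → ℂ} (hg : Integrable g) :
    Continuous (𝓕 g : V → ℂ) :=
  VectorFourier.fourierIntegral_continuous Real.continuous_fourierChar
    (L := innerₗ V) continuous_inner hg

/-- On `L¹ ∩ L²`, the `L²` Fourier transform is given by the Fourier integral. -/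
theorem coeFn_fourier_ae_eq (g : Lp ℂ 2 (volume : Measure V)) (hg : Integrable g) :
    (𝓕 g : Lp ℂ 2 (volume : Measure V)) =ᵐ[volume] (𝓕 (g : V → ℂ) : V → ℂ) := by
  refine ae_eq_of_integral_contDiff_smul_eq
    ((Lp.memLp _).locallyIntegrable (by norm_num))
    (continuous_fourier_of_integrable hg).locallyIntegrable fun u hu_smooth hu_supp ↦ ?_
  have hu₁ : HasCompactSupport (Complex.ofRealCLM ∘ u) := hu_supp.comp_left rfl
  have hu₂ : ContDiff ℝ ∞ (Complex.ofRealCLM ∘ u) := by fun_prop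
  let w : 𝓢(V, ℂ) := hu₁.toSchwartzMap hu₂
  calc ∫ x, u x • (𝓕 g : Lp ℂ 2 (volume : Measure V)) x
      = Lp.toTemperedDistribution (𝓕 g) w := by
        simp [w]
    _ = ∫ x, (𝓕 w) x • g x := by
        rw [← Lp.fourier_toTemperedDistribution_eq, TemperedDistribution.fourier_apply,
          Lp.toTemperedDistribution_apply]
    _ = ∫ x, w x • (𝓕 (g : V → ℂ)) x := by
        simpa using! VectorFourier.integral_fourierIntegral_smul_eq_flip (L := innerₗ V)
          Real.continuous_fourierChar continuous_inner w.integrable hg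
    _ = _ := by simp [w]

theorem L2_norm_sq_eq_integral {α : Type*} [MeasurableSpace α] {μ : Measure α}
    (g : Lp ℂ 2 μ) : ‖g‖ ^ 2 = ∫ x, ‖g x‖ ^ 2 ∂μ := by
  have h := inner_self_eq_norm_sq_to_K (𝕜 := ℂ) g
  rw [L2.inner_def] at h
  simp only [inner_self_eq_norm_sq_to_K] at h
  norm_cast at h
  exact_mod_cast h.symm

/-- Plancherel's theorem for the Fourier integral of a function in `L¹ ∩ L²`. -/
theorem integral_norm_fourier_sq (g : Lp ℂ 2 (volume : Measure V)) (hg : Integrable g) :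
    ∫ p, ‖𝓕 (g : V → ℂ) p‖ ^ 2 = ‖g‖ ^ 2 := by
  rw [← Lp.norm_fourier_eq g, L2_norm_sq_eq_integral]
  refine integral_congr_ae ?_
  filter_upwards [coeFn_fourier_ae_eq g hg] with p hp
  rw [hp]

/-- The Fourier integral with kernel `exp (-i p·x)` as a rescaling of the one with kernel
`exp (-2πi p·x)`. -/
theorem integral_mul_exp_eq_fourier (g : V → ℂ) (p : V) :
    ∫ x, g x * Complex.exp (-Complex.I * ((inner ℝ p x : ℝ) : ℂ)) =
      𝓕 g ((2 * Real.pi)⁻¹ • p) := by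
  rw [Real.fourier_eq']
  refine integral_congr_ae (Filter.Eventually.of_forall fun x ↦ ?_)
  have hpi : (Real.pi : ℂ) ≠ 0 := by exact_mod_cast Real.pi_ne_zero
  simp only [smul_eq_mul, mul_comm (g x)]
  congr 2
  rw [inner_smul_right, real_inner_comm]
  push_cast
  field_simp

end PlancherelIntegral

/-- An `L²` function vanishing outside a set of finite measure is integrable. -/
theorem Lp_two_integrable_of_ae_eq_zero_off {α : Type*} [MeasurableSpace α] {μ : Measure α}
    {Ω : Set α} (hΩ : μ Ω < ⊤) (g : Lp ℂ 2 μ)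
    (hg : ∀ᵐ x ∂μ, x ∉ Ω → g x = 0) : Integrable g μ := by
  have : IsFiniteMeasure (μ.restrict Ω) := ⟨by simpa using hΩ⟩
  have h : IntegrableOn g Ω μ := ((Lp.memLp g).restrict Ω).integrable (by norm_num)
  exact h.integrable_of_ae_notMem_eq_zero hg

/-- **Bessel's inequality** for the Fourier integrals of an orthonormal family of functions
vanishing outside a set of finite measure. -/
theorem sum_norm_integral_mul_exp_sq_le {V : Type*} [NormedAddCommGroup V] [InnerProductSpace ℝ V]
    [MeasurableSpace V] [BorelSpace V] [SecondCountableTopology V] {μ : Measure V} {Ω : Set V}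
    (hΩmeas : MeasurableSet Ω) (hΩ : μ Ω < ⊤) {I : Type*} {φ : I → Lp ℂ 2 μ}
    (hφ : Orthonormal ℂ φ) (hsupp : ∀ i, ∀ᵐ x ∂μ, x ∉ Ω → φ i x = 0) (s : Finset I) (p : V) :
    ∑ i ∈ s, ‖∫ x, φ i x * Complex.exp (-Complex.I * ((inner ℝ p x : ℝ) : ℂ)) ∂μ‖ ^ 2
      ≤ (μ Ω).toReal := by
  let e : V → ℂ := fun x ↦ Complex.exp (Complex.I * ((inner ℝ p x : ℝ) : ℂ))
  have he : Continuous e := by fun_prop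
  have he_norm : ∀ x, ‖e x‖ = 1 := fun x ↦ by
    simp only [e, mul_comm Complex.I, Complex.norm_exp_ofReal_mul_I]
  have hmem : MemLp (Ω.indicator e) 2 μ := by
    have : IsFiniteMeasure (μ.restrict Ω) := ⟨by simpa using hΩ⟩
    rw [memLp_indicator_iff_restrict hΩmeas]
    exact MemLp.of_bound he.aestronglyMeasurable 1 (.of_forall fun x ↦ (he_norm x).le)
  have hnorm : ‖hmem.toLp _‖ ^ 2 = (μ Ω).toReal := by
    rw [L2_norm_sq_eq_integral]
    calc ∫ x, ‖hmem.toLp _ x‖ ^ 2 ∂μ = ∫ x, Ω.indicator (fun _ ↦ (1 : ℝ)) x ∂μ := by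
          refine integral_congr_ae ?_
          filter_upwards [hmem.coeFn_toLp] with x hx
          by_cases hxΩ : x ∈ Ω <;> simp [hx, hxΩ, he_norm]
      _ = (μ Ω).toReal := by simp [integral_indicator hΩmeas, Measure.real]
  have hinner : ∀ i, ∫ x, φ i x * Complex.exp (-Complex.I * ((inner ℝ p x : ℝ) : ℂ)) ∂μ =
      inner ℂ (hmem.toLp _) (φ i) := fun i ↦ by
    rw [L2.inner_def]
    refine integral_congr_ae ?_
    filter_upwards [hmem.coeFn_toLp, hsupp i] with x hx hx0
    by_cases hxΩ : x ∈ Ω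
    · simp [hx, hxΩ, e, ← Complex.exp_conj]
    · simp [hx0 hxΩ]
  simp_rw [hinner, norm_inner_symm (hmem.toLp _)]
  exact (hφ.sum_inner_products_le _).trans_eq hnorm

/-- **Jensen's inequality** for a probability density `w`. -/
theorem ConvexOn.map_integral_mul_density_le {α : Type*} [MeasurableSpace α] {μ : Measure α}
    {f : ℝ → ℝ} {s : Set ℝ} (hf : ConvexOn ℝ s f) (hfc : ContinuousOn f s) (hs : IsClosed s)
    {w g : α → ℝ} (hw : Measurable w) (hw0 : ∀ x, 0 ≤ w x) (hw1 : ∫ x, w x ∂μ = 1)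
    (hgs : ∀ x, g x ∈ s) (hg : Integrable (fun x ↦ g x * w x) μ)
    (hfg : Integrable (fun x ↦ f (g x) * w x) μ) :
    f (∫ x, g x * w x ∂μ) ≤ ∫ x, f (g x) * w x ∂μ := by
  let ν := μ.withDensity fun x ↦ ENNReal.ofReal (w x)
  have hw_int : Integrable w μ := by
    by_contra h
    simp [integral_undef h] at hw1
  have hν : IsProbabilityMeasure ν := ⟨by
    rw [withDensity_apply _ .univ, Measure.restrict_univ,
      ← ofReal_integral_eq_lintegral_ofReal hw_int (.of_forall hw0), hw1, ENNReal.ofReal_one]⟩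
  have hint : ∀ h : α → ℝ, Integrable (fun x ↦ h x * w x) μ → Integrable h ν := fun h hh ↦ by
    rw [integrable_withDensity_iff_integrable_smul' hw.ennreal_ofReal (by simp)]
    simpa [ENNReal.toReal_ofReal (hw0 _), mul_comm] using hh
  have heq : ∀ h : α → ℝ, ∫ x, h x ∂ν = ∫ x, h x * w x ∂μ := fun h ↦ by
    rw [integral_withDensity_eq_integral_toReal_smul hw.ennreal_ofReal (by simp)]
    simp [ENNReal.toReal_ofReal (hw0 _), mul_comm]
  have h := hf.map_integral_le hfc hs (.of_forall hgs) (hint g hg) (hint (f ∘ g) hfg)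
  rwa [heq, heq] at h

/-- Li–Yau type bound for orthonormal families: if `(φ_i)` is an orthonormal family in `L²(ℝⁿ)`
supported in a set `Ω` of finite measure, `F i` is the Fourier transform of `φ_i`, and
`f : [0,∞) → [0,∞)` is convex, continuous and integrable against `p ↦ ‖p‖²`, then
`Σ_i f(∫ ‖p‖² |φ̂_i(p)|² dp) ≤ (2π)^{−n} |Ω| ∫ f(‖p‖²) dp`. -/
theorem li_yau_bound (n : ℕ) (hn : 1 ≤ n)
    (Ω : Set (EuclideanSpace ℝ (Fin n))) (hΩmeas : MeasurableSet Ω) (hΩ : volume Ω < ⊤)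
    (I : Type*) (φ : I → Lp ℂ 2 (volume : Measure (EuclideanSpace ℝ (Fin n))))
    (hortho : Orthonormal ℂ φ)
    (hsupp : ∀ i : I, ∀ᵐ x : EuclideanSpace ℝ (Fin n), x ∉ Ω → φ i x = 0)
    (F : I → EuclideanSpace ℝ (Fin n) → ℂ)
    (hF : ∀ i p, F i p = (((2 * Real.pi) ^ (-(n : ℝ) / 2) : ℝ) : ℂ) *
        ∫ x : EuclideanSpace ℝ (Fin n),
          φ i x * Complex.exp (-Complex.I * ((inner ℝ p x : ℝ) : ℂ)))
    (f : ℝ → ℝ) (hf0 : ∀ t, 0 ≤ t → 0 ≤ f t)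
    (hfconv : ConvexOn ℝ (Set.Ici 0) f) (hfcont : ContinuousOn f (Set.Ici 0))
    (hfint : Integrable (fun p : EuclideanSpace ℝ (Fin n) => f (‖p‖ ^ 2)))
    (hkin : ∀ i : I,
      Integrable (fun p : EuclideanSpace ℝ (Fin n) => ‖p‖ ^ 2 * ‖F i p‖ ^ 2)) :
    ∑' i : I, f (∫ p : EuclideanSpace ℝ (Fin n), ‖p‖ ^ 2 * ‖F i p‖ ^ 2)
      ≤ (2 * Real.pi) ^ (-(n : ℝ)) * (volume Ω).toReal *
          ∫ p : EuclideanSpace ℝ (Fin n), f (‖p‖ ^ 2) := by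
  set c : ℝ := (2 * Real.pi) ^ (-(n : ℝ))
  have h2pi : (0 : ℝ) < 2 * Real.pi := Real.two_pi_pos
  have hc : 0 ≤ c := Real.rpow_nonneg h2pi.le _
  have hint i : Integrable (φ i) := Lp_two_integrable_of_ae_eq_zero_off hΩ _ (hsupp i)
  have hFsq i p : ‖F i p‖ ^ 2 = c *
      ‖∫ x, φ i x * Complex.exp (-Complex.I * ((inner ℝ p x : ℝ) : ℂ))‖ ^ 2 := by
    rw [hF, norm_mul, mul_pow, Complex.norm_real, Real.norm_eq_abs, sq_abs,
      ← Real.rpow_mul_natCast h2pi.le]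
    congr 2
    push_cast
    ring
  have hFmeas i : Measurable fun p ↦ ‖F i p‖ ^ 2 := by
    simp_rw [hFsq, integral_mul_exp_eq_fourier]
    exact (((continuous_fourier_of_integrable (hint i)).comp
      (continuous_const_smul _)).norm.pow 2 |>.const_mul c).measurable
  have hF1 i : ∫ p, ‖F i p‖ ^ 2 = 1 := by
    simp_rw [hFsq, integral_mul_exp_eq_fourier, integral_const_mul]
    rw [Measure.integral_comp_inv_smul_of_nonneg volume
      (fun p ↦ ‖FourierTransform.fourier (φ i : EuclideanSpace ℝ (Fin n) → ℂ) p‖ ^ 2) h2pi.le,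
      integral_norm_fourier_sq _ (hint i), hortho.1 i, finrank_euclideanSpace_fin, smul_eq_mul,
      one_pow, mul_one, ← Real.rpow_natCast, ← Real.rpow_add h2pi, neg_add_cancel, Real.rpow_zero]
  have hbessel (s : Finset I) p : ∑ i ∈ s, ‖F i p‖ ^ 2 ≤ c * (volume Ω).toReal := by
    simp_rw [hFsq, ← Finset.mul_sum]
    exact mul_le_mul_of_nonneg_left
      (sum_norm_integral_mul_exp_sq_le hΩmeas hΩ hortho hsupp s p) hc
  have hfF i : Integrable fun p ↦ f (‖p‖ ^ 2) * ‖F i p‖ ^ 2 := by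
    refine hfint.mul_bdd (c := c * (volume Ω).toReal) (hFmeas i).aestronglyMeasurable
      (.of_forall fun p ↦ ?_)
    simpa using hbessel {i} p
  have hnonneg i : 0 ≤ f (∫ p, ‖p‖ ^ 2 * ‖F i p‖ ^ 2) :=
    hf0 _ (integral_nonneg fun p ↦ by positivity)
  refine Real.tsum_le_of_sum_le hnonneg fun s ↦ ?_
  calc ∑ i ∈ s, f (∫ p, ‖p‖ ^ 2 * ‖F i p‖ ^ 2)
      ≤ ∑ i ∈ s, ∫ p, f (‖p‖ ^ 2) * ‖F i p‖ ^ 2 := Finset.sum_le_sum fun i _ ↦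
        hfconv.map_integral_mul_density_le hfcont isClosed_Ici (hFmeas i)
          (fun p ↦ sq_nonneg _) (hF1 i) (fun p ↦ sq_nonneg ‖p‖) (hkin i) (hfF i)
    _ = ∫ p, f (‖p‖ ^ 2) * ∑ i ∈ s, ‖F i p‖ ^ 2 := by
        simp_rw [Finset.mul_sum]
        exact (integral_finsetSum _ fun i _ ↦ hfF i).symm
    _ ≤ ∫ p, f (‖p‖ ^ 2) * (c * (volume Ω).toReal) := by
        refine integral_mono ?_ (hfint.mul_const _) fun p ↦
          mul_le_mul_of_nonneg_left (hbessel s p) (hf0 _ (sq_nonneg _))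
        simp_rw [Finset.mul_sum]
        exact integrable_finsetSum _ fun i _ ↦ hfF i
    _ = c * (volume Ω).toReal * ∫ p, f (‖p‖ ^ 2) := by
        rw [integral_mul_const, mul_comm]
end
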